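/- Fix (α, β, θ) ∈ (0,1)³ with α > η^hyp_θ(β). Then for every sequence of measurable tests T̂ of H_0^{(p)} against H_1^{(p)}, liminf_{p→∞} Err(T̂) ≥ 1. -/

import Mathlib

open MeasureTheory ProbabilityTheory Filter
open scoped ENNReal NNReal Classical BigOperators

namespace ARWPaper

/-- `n = ⌈p^θ⌉`. -/
noncomputable def nDim (p : ℕ) (θ : ℝ) : ℕ := ⌈(p : ℝ) ^ θ⌉₊

/-- Law of a single class label: uniform on `{-1, 1}`. -/
noncomputable def signLaw : Measure ℝ :=
  (1 / 2 : ℝ≥0∞) • Measure.dirac (1 : ℝ) + (1 / 2 : ℝ≥0∞) • Measure.dirac (-1 : ℝ)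

/-- Law of a single coordinate of `μ`: `τ` w.p. `ε`, `0` w.p. `1 - ε`. -/
noncomputable def muLaw (ε τ : ℝ) : Measure ℝ :=
  ENNReal.ofReal (1 - ε) • Measure.dirac (0 : ℝ) + ENNReal.ofReal ε • Measure.dirac τ

/-- Standard Gaussian product measure on `ℝ^n`. -/
noncomputable def gaussPi (n : ℕ) : Measure (Fin n → ℝ) :=
  Measure.pi fun _ => gaussianReal 0 1

/-- Law of the noise matrix `Z` (i.i.d. `N(0,1)` entries, rows indexed by `Fin n`). -/
noncomputable def noiseLaw (n p : ℕ) : Measure (Fin n → Fin p → ℝ) :=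
  Measure.pi fun _ => gaussPi p

/-- Sample space for `(ℓ, μ, Z)`. -/
abbrev Omega (n p : ℕ) := (Fin n → ℝ) × (Fin p → ℝ) × (Fin n → Fin p → ℝ)

/-- Joint law of `(ℓ, μ, Z)`. -/
noncomputable def jointLaw (n p : ℕ) (ε τ : ℝ) : Measure (Omega n p) :=
  (Measure.pi fun _ : Fin n => signLaw).prod
    ((Measure.pi fun _ : Fin p => muLaw ε τ).prod (noiseLaw n p))

/-- Data matrix `X = ℓ μ' + Z`. -/
def dataMap {n p : ℕ} (ω : Omega n p) : Fin n → Fin p → ℝ :=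
  fun i j => ω.1 i * ω.2.1 j + ω.2.2 i j

/-- Hamming clustering error of a clustering procedure `ell`, where the observed data
matrix is `D ω`. -/
noncomputable def hammingClu (n p : ℕ) (ε τ : ℝ)
    (D : Omega n p → Fin n → Fin p → ℝ)
    (ell : (Fin n → Fin p → ℝ) → Fin n → ℝ) : ℝ :=
  (n : ℝ)⁻¹ * min
    (∑ i : Fin n, ((jointLaw n p ε τ) {ω | ell (D ω) i ≠ ω.1 i}).toReal)
    (∑ i : Fin n, ((jointLaw n p ε τ) {ω | ell (D ω) i ≠ -ω.1 i}).toReal)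

/-- Hamming error for signal (support) recovery. -/
noncomputable def hammingSig (n p : ℕ) (ε τ : ℝ)
    (D : Omega n p → Fin n → Fin p → ℝ)
    (S : (Fin n → Fin p → ℝ) → Finset (Fin p)) : ℝ :=
  ((p : ℝ) * ε)⁻¹ * ∑ j : Fin p,
    (((jointLaw n p ε τ) {ω | ω.2.1 j = 0 ∧ j ∈ S (D ω)}).toReal +
      ((jointLaw n p ε τ) {ω | ω.2.1 j ≠ 0 ∧ j ∉ S (D ω)}).toReal)

/-- Sum of type I and type II testing errors of the rejection region `R`. -/
noncomputable def testErr (n p : ℕ) (ε τ : ℝ)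
    (R : Set (Fin n → Fin p → ℝ)) : ℝ :=
  ((noiseLaw n p) R).toReal + ((jointLaw n p ε τ) {ω | dataMap ω ∉ R}).toReal

/-- Statistical boundary for clustering. -/
noncomputable def etaClu (θ β : ℝ) : ℝ :=
  if β < (1 - θ) / 2 then (1 - 2 * β) / 2
  else if β < 1 - θ then θ / 2
  else (1 - β) / 2

/-- CTUB boundary for clustering. -/
noncomputable def etaCluT (θ β : ℝ) : ℝ :=
  if β < (1 - θ) / 2 then (1 - 2 * β) / 2
  else if β < 1 / 2 then (1 + θ - 2 * β) / 4
  else if β < 1 - θ / 2 then θ / 4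
  else (1 - β) / 2

/-- Statistical boundary for signal recovery. -/
noncomputable def etaSig (θ β : ℝ) : ℝ :=
  if β < 1 - θ then θ / 2 else (1 + θ - β) / 4

/-- CTUB boundary for signal recovery. -/
noncomputable def etaSigT (θ β : ℝ) : ℝ :=
  if β < (1 - θ) / 2 then θ / 2
  else if β < 1 / 2 then (1 + θ - 2 * β) / 4
  else θ / 4

noncomputable def etaHyp1 (θ β : ℝ) : ℝ := (2 + θ - 4 * β) / 4
noncomputable def etaHyp2 (θ β : ℝ) : ℝ := min (θ / 2) ((1 + θ - β) / 4)
noncomputable def etaHyp (θ β : ℝ) : ℝ := max (etaHyp1 θ β) (etaHyp2 θ β)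
noncomputable def etaHypT (θ β : ℝ) : ℝ := max (etaHyp1 θ β) (θ / 4)

/-- Standard phase function `ρ*`. -/
noncomputable def rhoStar (b : ℝ) : ℝ :=
  if b < 3 / 4 then b - 1 / 2 else (1 - Real.sqrt (1 - b)) ^ 2

/-- Phase function for IF-PCA. -/
noncomputable def rhoStarTheta (θ β : ℝ) : ℝ :=
  (1 - θ) * rhoStar (1 / 2 + (β - 1 / 2) / (1 - θ))

/-- Euclidean norm of a vector. -/
noncomputable def l2 {n : ℕ} (v : Fin n → ℝ) : ℝ := Real.sqrt (∑ i, v i ^ 2)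

/-- Entrywise sup-norm of a vector. -/
noncomputable def linf {n : ℕ} (v : Fin n → ℝ) : ℝ := ⨆ i, |v i|

/-- `cos(x, y) = |⟨x/‖x‖, y/‖y‖⟩|`. -/
noncomputable def cosv {n : ℕ} (x y : Fin n → ℝ) : ℝ :=
  |∑ i, x i * y i| / (l2 x * l2 y)

/-- Spectral (operator) norm of a matrix. -/
noncomputable def specNorm {m k : ℕ} (A : Matrix (Fin m) (Fin k) ℝ) : ℝ :=
  sSup ((fun v => l2 (A.mulVec v)) '' {v | l2 v ≤ 1})

/-- Simple Aggregation clustering: entrywise sign of the sum of all columns. -/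
noncomputable def ellSimpleAgg {n p : ℕ} (X : Fin n → Fin p → ℝ) : Fin n → ℝ :=
  fun i => Real.sign (∑ j, X i j)

/-- `S` picks, for every data matrix, a size-`N` subset maximizing `‖∑_{j ∈ S} x_j‖₁`. -/
def IsSparseAggMaximizer {n p : ℕ} (N : ℕ)
    (S : (Fin n → Fin p → ℝ) → Finset (Fin p)) : Prop :=
  ∀ X, (S X).card = N ∧
    ∀ T : Finset (Fin p), T.card = N →
      ∑ i, |∑ j ∈ T, X i j| ≤ ∑ i, |∑ j ∈ S X, X i j|

/-- Sparse Aggregation clustering. -/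
noncomputable def ellSparseAgg {n p : ℕ}
    (S : (Fin n → Fin p → ℝ) → Finset (Fin p)) (X : Fin n → Fin p → ℝ) :
    Fin n → ℝ :=
  fun i => Real.sign (∑ j ∈ S X, X i j)

/-- Gram matrix `X X'`. -/
def gram {n p : ℕ} (X : Fin n → Fin p → ℝ) : Matrix (Fin n) (Fin n) ℝ :=
  Matrix.of fun i i' => ∑ j, X i j * X i' j

/-- `ξ` is a unit eigenvector of `A` associated with its largest eigenvalue. -/
def IsTopEigenvector {n : ℕ} (A : Matrix (Fin n) (Fin n) ℝ) (ξ : Fin n → ℝ) : Prop :=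
  (∑ i, ξ i ^ 2) = 1 ∧
    ∃ lam : ℝ, A.mulVec ξ = lam • ξ ∧
      ∀ (lam' : ℝ) (v : Fin n → ℝ), v ≠ 0 → A.mulVec v = lam' • v → lam' ≤ lam

/-- χ²-screening: the set of selected features. -/
noncomputable def chiSel {n p : ℕ} (q : ℝ) (X : Fin n → Fin p → ℝ) : Finset (Fin p) :=
  Finset.univ.filter fun j =>
    Real.sqrt (2 * q * Real.log p) ≤ ((∑ i, X i j ^ 2) - n) / Real.sqrt (2 * n)

/-- Post-selection Gram matrix `X^{(q)} (X^{(q)})'`. -/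
noncomputable def gramSel {n p : ℕ} (q : ℝ) (X : Fin n → Fin p → ℝ) :
    Matrix (Fin n) (Fin n) ℝ :=
  Matrix.of fun i i' => ∑ j ∈ chiSel q X, X i j * X i' j

/-- IF-PCA calibration `τ_p* = p^{-θ/4} (4 r log p)^{1/4}`. -/
noncomputable def tauStar (p : ℕ) (θ r : ℝ) : ℝ :=
  (p : ℝ) ^ (-(θ / 4)) * (4 * r * Real.log p) ^ ((1 : ℝ) / 4)

/-- The ideal threshold `q*` of IF-PCA in the Region of Possibility. -/
noncomputable def qStar (θ β r : ℝ) : ℝ :=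
  if (β - θ / 2) / 3 < r then (β - θ / 2 + r) ^ 2 / (4 * r) else 4 * r

/-- Support of `μ`. -/
noncomputable def suppSet {p : ℕ} (μ : Fin p → ℝ) : Finset (Fin p) :=
  Finset.univ.filter fun j => μ j ≠ 0

/-- The event `D_p`: `| |S(μ)| - p ε_p | ≤ √(6 p ε_p log p)` with `ε_p = p^{-β}`. -/
def inDp (β : ℝ) {p : ℕ} (μ : Fin p → ℝ) : Prop :=
  |((suppSet μ).card : ℝ) - (p : ℝ) * (p : ℝ) ^ (-β)| ≤
    Real.sqrt (6 * ((p : ℝ) * (p : ℝ) ^ (-β)) * Real.log p)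

/-- Selection threshold `n + 2√(q n log p)` for the squared column norm. -/
noncomputable def thresh (p n : ℕ) (q : ℝ) : ℝ :=
  (n : ℝ) + 2 * Real.sqrt (q * n * Real.log p)

/-- `π₀ = P(‖z‖² > n + 2√(q n log p))`, `z ~ N(0, I_n)`. -/
noncomputable def pi0 (p n : ℕ) (q : ℝ) : ℝ :=
  ((gaussPi n) {z | thresh p n q < ∑ i, z i ^ 2}).toReal

/-- `π₁ = P(‖z + τ ℓ‖² > n + 2√(q n log p))`, `z ~ N(0, I_n)`. -/
noncomputable def pi1 (p : ℕ) {n : ℕ} (q τ : ℝ) (ℓ : Fin n → ℝ) : ℝ :=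
  ((gaussPi n) {z | thresh p n q < ∑ i, (z i + τ * ℓ i) ^ 2}).toReal

/-- Expected number of selected useless features (`s = |S(μ)|`). -/
noncomputable def m0q (p n : ℕ) (q : ℝ) (s : ℕ) : ℝ := ((p : ℝ) - s) * pi0 p n q

/-- Expected number of selected useful features. -/
noncomputable def m1q (p : ℕ) {n : ℕ} (q τ : ℝ) (ℓ : Fin n → ℝ) (s : ℕ) : ℝ :=
  (s : ℝ) * pi1 p q τ ℓ

/-- `m^{(q)}`. -/
noncomputable def mq (p : ℕ) {n : ℕ} (q τ : ℝ) (ℓ : Fin n → ℝ) (s : ℕ) : ℝ :=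
  m0q p n q s + m1q p q τ ℓ s

/-- `m_*^{(q)}`. -/
noncomputable def mstarq (p : ℕ) {n : ℕ} (q τ : ℝ) (ℓ : Fin n → ℝ) (s : ℕ) : ℝ :=
  ((p : ℝ) - s) * (n : ℝ)⁻¹ *
      (∫ z in {z : Fin n → ℝ | thresh p n q < ∑ i, z i ^ 2}, (∑ i, z i ^ 2) ∂gaussPi n) +
    (s : ℝ) * (n : ℝ)⁻¹ *
      (∫ z in {z : Fin n → ℝ | thresh p n q < ∑ i, (z i + τ * ℓ i) ^ 2},
        (∑ i, z i ^ 2) ∂gaussPi n)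

/-- The threshold `q̃(β, θ, r)` separating the "fat" and "skinny" cases. -/
noncomputable def qTilde (β θ r : ℝ) : ℝ :=
  if β < 1 - θ then max (1 - θ) ((Real.sqrt (1 - β - θ) + Real.sqrt r) ^ 2)
  else 1 - θ

/-- The set of features selected by χ²-screening, in terms of `(ℓ, μ, Z)`. -/
noncomputable def selSet {n p : ℕ} (q : ℝ) (ℓ : Fin n → ℝ) (μ : Fin p → ℝ)
    (Z : Fin n → Fin p → ℝ) : Finset (Fin p) :=
  chiSel q fun i j => ℓ i * μ j + Z i j

/-- `Z^{(q)} (Z^{(q)})'`. -/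
noncomputable def gramZq {n p : ℕ} (q : ℝ) (ℓ : Fin n → ℝ) (μ : Fin p → ℝ)
    (Z : Fin n → Fin p → ℝ) : Matrix (Fin n) (Fin n) ℝ :=
  Matrix.of fun i i' => ∑ j ∈ selSet q ℓ μ Z, Z i j * Z i' j

/-- `X^{(q)} (X^{(q)})'`. -/
noncomputable def gramXq {n p : ℕ} (q : ℝ) (ℓ : Fin n → ℝ) (μ : Fin p → ℝ)
    (Z : Fin n → Fin p → ℝ) : Matrix (Fin n) (Fin n) ℝ :=
  Matrix.of fun i i' =>
    ∑ j ∈ selSet q ℓ μ Z, (ℓ i * μ j + Z i j) * (ℓ i' * μ j + Z i' j)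

/-- The matrix `ℓ (μ^{(q)})' (Z^{(q)})' + Z^{(q)} μ^{(q)} ℓ'`. -/
noncomputable def crossMat {n p : ℕ} (q : ℝ) (ℓ : Fin n → ℝ) (μ : Fin p → ℝ)
    (Z : Fin n → Fin p → ℝ) : Matrix (Fin n) (Fin n) ℝ :=
  Matrix.of fun i i' =>
    ℓ i * (∑ j ∈ selSet q ℓ μ Z, Z i' j * μ j) +
      (∑ j ∈ selSet q ℓ μ Z, Z i j * μ j) * ℓ i'

/-- Colored-noise data matrix `X = ℓ μ' + A Z B`. -/
noncomputable def dataColored {n p : ℕ} (A : Matrix (Fin n) (Fin n) ℝ)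
    (B : Matrix (Fin p) (Fin p) ℝ) (ω : Omega n p) : Fin n → Fin p → ℝ :=
  fun i j => ω.1 i * ω.2.1 j + (A * Matrix.of ω.2.2 * B) i j

/-- Colored-noise data matrix `X = ℓ μ' + Z B`. -/
noncomputable def dataColoredB {n p : ℕ} (B : Matrix (Fin p) (Fin p) ℝ)
    (ω : Omega n p) : Fin n → Fin p → ℝ :=
  fun i j => ω.1 i * ω.2.1 j + (Matrix.of ω.2.2 * B) i j

/-- `y_*^{(sa)} = n^{-1/2} X' ℓ̂_*^{(sa)}`. -/
noncomputable def ySA {n p : ℕ} (X : Fin n → Fin p → ℝ) : Fin p → ℝ :=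
  fun j => (Real.sqrt n)⁻¹ * ∑ i, X i j * ellSimpleAgg X i

/-- `Ŝ_*^{(sa)}`: thresholding `y_*^{(sa)}` at the universal threshold. -/
noncomputable def ShatSA {n p : ℕ} (X : Fin n → Fin p → ℝ) : Finset (Fin p) :=
  Finset.univ.filter fun j => Real.sqrt (2 * Real.log p) ≤ |ySA X j|

/-- `y_*^{(if)} = n^{-1/2} X' sgn(ξ)` for a given vector `ξ`. -/
noncomputable def yIF {n p : ℕ} (ξ : Fin n → ℝ) (X : Fin n → Fin p → ℝ) : Fin p → ℝ :=
  fun j => (Real.sqrt n)⁻¹ * ∑ i, X i j * Real.sign (ξ i)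

/-- `Ŝ_*^{(if)}`: thresholding `y_*^{(if)}` at the universal threshold. -/
noncomputable def ShatIF {n p : ℕ} (ξ : Fin n → ℝ) (X : Fin n → Fin p → ℝ) : Finset (Fin p) :=
  Finset.univ.filter fun j => Real.sqrt (2 * Real.log p) ≤ |yIF ξ X j|

/-- Rejection region of the Simple Aggregation test `T̂_*^{(sa)}`. -/
noncomputable def rejSA {n p : ℕ} : Set (Fin n → Fin p → ℝ) :=
  {X | 2 * Real.sqrt (2 * Real.log p) ≤
    ((p : ℝ) * (∑ i, ((p : ℝ)⁻¹ * ∑ j, X i j) ^ 2) - n) / Real.sqrt (2 * n)}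

/-- Rejection region of the Sparse Aggregation test `T̂_N^{(sa)}`. -/
noncomputable def rejSparse {n p : ℕ} (N : ℕ)
    (S : (Fin n → Fin p → ℝ) → Finset (Fin p)) : Set (Fin n → Fin p → ℝ) :=
  {X | Real.sqrt (2 / Real.pi) * n + Real.sqrt (2 * n * (N + 2) * Real.log p) ≤
    (Real.sqrt N)⁻¹ * ∑ i, |∑ j ∈ S X, X i j|}

/-- χ² P-value of feature `j`. -/
noncomputable def pvalue {n p : ℕ} (X : Fin n → Fin p → ℝ) (j : Fin p) : ℝ :=
  ((gaussPi n) {z | (∑ i, X i j ^ 2) ≤ ∑ i, z i ^ 2}).toReal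

/-- Higher Criticism statistic. -/
noncomputable def HCstat {n p : ℕ} (X : Fin n → Fin p → ℝ) : ℝ :=
  sSup {h : ℝ | ∃ i : Fin p, 2 * (i.val + 1) ≤ p ∧
    h = Real.sqrt p * (((i.val : ℝ) + 1) / p - pvalue X (Tuple.sort (pvalue X) i)) /
      Real.sqrt (pvalue X (Tuple.sort (pvalue X) i) *
        (1 - pvalue X (Tuple.sort (pvalue X) i)))}

/-- Rejection region of the Higher Criticism test. -/
noncomputable def rejHC {n p : ℕ} : Set (Fin n → Fin p → ℝ) :=
  {X | 2 * Real.sqrt (2 * Real.log (Real.log p)) ≤ HCstat X}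

/-- Lebesgue measure on the space of `n × p` matrices. -/
noncomputable def lebPi (n p : ℕ) : Measure (Fin n → Fin p → ℝ) :=
  Measure.pi fun _ : Fin n => Measure.pi fun _ : Fin p => (volume : Measure ℝ)

/-- Law of `X` in Experiment 1 (`X = ℓ μ' + c_p Z`) with `ℓ_i` forced to be `s`. -/
noncomputable def condLaw1 (n p : ℕ) (ε τ cp : ℝ) (i : Fin n) (s : ℝ) :
    Measure (Fin n → Fin p → ℝ) :=
  (jointLaw n p ε τ).map fun ω => fun i' j =>
    Function.update ω.1 i s i' * ω.2.1 j + cp * ω.2.2 i' j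

/-- Law of `X` in Experiment 2 (`X = ℓ μ' + c_p Z + W`) with `ℓ_i` forced to be `s`,
where `W ~ ν` is independent of `(ℓ, μ, Z)`. -/
noncomputable def condLaw2 (n p : ℕ) (ε τ cp : ℝ)
    (ν : Measure (Fin n → Fin p → ℝ)) (i : Fin n) (s : ℝ) :
    Measure (Fin n → Fin p → ℝ) :=
  ((jointLaw n p ε τ).prod ν).map fun ωw => fun i' j =>
    Function.update ωw.1.1 i s i' * ωw.1.2.1 j + cp * ωw.1.2.2 i' j + ωw.2 i' j

end ARWPaper

namespace ARWPaper

lemma lintegral_pi_prod {ι E : Type*} [Fintype ι] [MeasurableSpace E] (μ : ι → Measure E)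
    [∀ i, IsProbabilityMeasure (μ i)] {f : ι → E → ℝ≥0∞} (hf : ∀ i, Measurable (f i)) :
    ∫⁻ x, ∏ i, f i (x i) ∂(Measure.pi μ) = ∏ i, ∫⁻ x, f i x ∂(μ i) := by
  rw [lintegral_prod_eq_prod_lintegral_of_indepFun Finset.univ
    (fun i (x : ι → E) => f i (x i)) (iIndepFun_pi fun i => (hf i).aemeasurable)
    fun i => (hf i).comp (measurable_pi_apply i)]
  refine Finset.prod_congr rfl fun i _ => ?_
  exact (measurePreserving_eval μ i).lintegral_comp (hf i)

lemma pi_eq_withDensity {ι E : Type*} [Fintype ι] [MeasurableSpace E] (μ ν : ι → Measure E)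
    [∀ i, IsProbabilityMeasure (μ i)] [∀ i, IsProbabilityMeasure (ν i)]
    {f : ι → E → ℝ≥0∞} (hf : ∀ i, Measurable (f i)) (h : ∀ i, ν i = (μ i).withDensity (f i)) :
    Measure.pi ν = (Measure.pi μ).withDensity fun x => ∏ i, f i (x i) := by
  refine Measure.pi_eq fun s hs => ?_
  rw [withDensity_apply _ (.univ_pi hs), ← lintegral_indicator (.univ_pi hs)]
  have h1 : ∀ x : ι → E, (Set.univ.pi s).indicator (fun x => ∏ i, f i (x i)) x
      = ∏ i, (s i).indicator (f i) (x i) := by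
    intro x
    by_cases hx : x ∈ Set.univ.pi s
    · rw [Set.indicator_of_mem hx]
      refine Finset.prod_congr rfl fun i _ => ?_
      rw [Set.indicator_of_mem (hx i trivial)]
    · rw [Set.indicator_of_notMem hx]
      simp only [Set.mem_pi, Set.mem_univ, true_imp_iff, not_forall] at hx
      obtain ⟨i, hi⟩ := hx
      exact (Finset.prod_eq_zero (Finset.mem_univ i) (Set.indicator_of_notMem hi _)).symm
  simp_rw [h1]
  rw [lintegral_pi_prod μ fun i => (hf i).indicator (hs i)]
  refine Finset.prod_congr rfl fun i _ => ?_
  rw [h i, withDensity_apply _ (hs i), lintegral_indicator (hs i)]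

/-- Likelihood ratio of `N(a, 1)` against `N(0, 1)`. -/
noncomputable def gaussLR (a z : ℝ) : ℝ≥0∞ := ENNReal.ofReal (Real.exp (a * z - a ^ 2 / 2))

lemma measurable_gaussLR_uncurry : Measurable fun q : ℝ × ℝ => gaussLR q.1 q.2 := by
  unfold gaussLR; fun_prop

lemma measurable_gaussLR (a : ℝ) : Measurable (gaussLR a) := by
  unfold gaussLR; fun_prop

lemma gaussianReal_map_add_eq_withDensity (a : ℝ) :
    (gaussianReal 0 1).map (a + ·) = (gaussianReal 0 1).withDensity (gaussLR a) := by
  rw [gaussianReal_map_const_add, gaussianReal_of_var_ne_zero _ one_ne_zero,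
    gaussianReal_of_var_ne_zero _ one_ne_zero,
    ← withDensity_mul _ (measurable_gaussianPDF _ _) (measurable_gaussLR a)]
  congr 1
  ext z
  simp only [Pi.mul_apply, gaussianPDF, gaussLR, gaussianPDFReal]
  rw [← ENNReal.ofReal_mul (by positivity), mul_assoc _ (Real.exp _) (Real.exp _), ← Real.exp_add]
  congr 3
  simp only [NNReal.coe_one]
  ring

lemma lintegral_gaussLR_mul (a b : ℝ) :
    ∫⁻ z, gaussLR a z * gaussLR b z ∂(gaussianReal 0 1)
      = ENNReal.ofReal (Real.exp (a * b)) := by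
  have h : ∀ z, gaussLR a z * gaussLR b z
      = ENNReal.ofReal (Real.exp (a * b)) * gaussLR (a + b) z := by
    intro z
    simp only [gaussLR]
    rw [← ENNReal.ofReal_mul (Real.exp_pos _).le, ← ENNReal.ofReal_mul (Real.exp_pos _).le,
      ← Real.exp_add, ← Real.exp_add]
    congr 2
    ring
  simp_rw [h]
  rw [lintegral_const_mul _ (measurable_gaussLR _), ← setLIntegral_univ (gaussLR (a + b)),
    ← withDensity_apply _ MeasurableSet.univ, ← gaussianReal_map_add_eq_withDensity,
    Measure.map_apply (by fun_prop) MeasurableSet.univ]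
  simp

/-- Likelihood ratio of the matrix `A + Z` against pure Gaussian noise `Z`. -/
noncomputable def matLR {n p : ℕ} (A Z : Fin n → Fin p → ℝ) : ℝ≥0∞ :=
  ∏ i, ∏ j, gaussLR (A i j) (Z i j)

lemma measurable_matLR {n p : ℕ} {Ω : Type*} [MeasurableSpace Ω]
    {A Z : Ω → Fin n → Fin p → ℝ} (hA : ∀ i j, Measurable fun ω => A ω i j)
    (hZ : ∀ i j, Measurable fun ω => Z ω i j) :
    Measurable fun ω => matLR (A ω) (Z ω) := by
  unfold matLR
  refine Finset.measurable_prod _ fun i _ => Finset.measurable_prod _ fun j _ => ?_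
  exact measurable_gaussLR_uncurry.comp ((hA i j).prodMk (hZ i j))

instance (n : ℕ) : IsProbabilityMeasure (gaussPi n) := by unfold gaussPi; infer_instance

instance (n p : ℕ) : IsProbabilityMeasure (noiseLaw n p) := by unfold noiseLaw; infer_instance

lemma noiseLaw_map_add {n p : ℕ} (A : Fin n → Fin p → ℝ) :
    (noiseLaw n p).map (fun Z i j => A i j + Z i j)
      = (noiseLaw n p).withDensity (matLR A) := by
  have hp (a : ℝ) : IsProbabilityMeasure ((gaussianReal 0 1).map (a + ·)) :=
    Measure.isProbabilityMeasure_map (by fun_prop)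
  have hrow (a : Fin p → ℝ) : (gaussPi p).map (fun z j => a j + z j)
      = (gaussPi p).withDensity fun z => ∏ j, gaussLR (a j) (z j) := by
    unfold gaussPi
    rw [Measure.pi_map_pi (f := fun j z => a j + z) fun j => by fun_prop]
    exact pi_eq_withDensity _ _ (fun j => measurable_gaussLR _)
      fun j => gaussianReal_map_add_eq_withDensity _
  have hp' (a : Fin p → ℝ) : IsProbabilityMeasure ((gaussPi p).map (fun z j => a j + z j)) :=
    Measure.isProbabilityMeasure_map
      (measurable_pi_lambda _ fun j => by fun_prop).aemeasurable
  unfold noiseLaw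
  refine (Measure.pi_map_pi (μ := fun _ => gaussPi p) (f := fun i z j => A i j + z j)
    fun i => (measurable_pi_lambda _ fun j => by fun_prop).aemeasurable).trans ?_
  have hf (i : Fin n) : Measurable fun z : Fin p → ℝ => ∏ j, gaussLR (A i j) (z j) :=
    Finset.measurable_prod _ fun j _ => (measurable_gaussLR _).comp (measurable_pi_apply j)
  exact pi_eq_withDensity (fun _ => gaussPi p)
    (fun i => (gaussPi p).map (fun z j => A i j + z j)) hf fun i => hrow _

lemma lintegral_matLR_mul {n p : ℕ} (A B : Fin n → Fin p → ℝ) :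
    ∫⁻ Z, matLR A Z * matLR B Z ∂(noiseLaw n p)
      = ENNReal.ofReal (Real.exp (∑ i, ∑ j, A i j * B i j)) := by
  have h1 : ∀ Z : Fin n → Fin p → ℝ, matLR A Z * matLR B Z
      = ∏ i, ∏ j, (gaussLR (A i j) (Z i j) * gaussLR (B i j) (Z i j)) := by
    intro Z
    simp only [matLR, Finset.prod_mul_distrib]
  have hm (i : Fin n) (j : Fin p) :
      Measurable fun z => gaussLR (A i j) z * gaussLR (B i j) z :=
    (measurable_gaussLR _).mul (measurable_gaussLR _)
  simp_rw [h1]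
  unfold noiseLaw gaussPi
  rw [lintegral_pi_prod (fun _ => Measure.pi fun _ => gaussianReal 0 1)
    (f := fun i z => ∏ j, (gaussLR (A i j) (z j) * gaussLR (B i j) (z j)))
    fun i => Finset.measurable_prod _ fun j _ => (hm i j).comp (measurable_pi_apply j)]
  simp_rw [Real.exp_sum]
  rw [ENNReal.ofReal_prod_of_nonneg fun i _ => by positivity]
  refine Finset.prod_congr rfl fun i _ => ?_
  rw [ENNReal.ofReal_prod_of_nonneg fun i _ => by positivity,
    lintegral_pi_prod (fun _ => gaussianReal 0 1) (hm i)]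
  exact Finset.prod_congr rfl fun j _ => lintegral_gaussLR_mul _ _

lemma truncated_chiSquare_bound {X : Type*} [MeasurableSpace X] (P : Measure X)
    [IsProbabilityMeasure P] {L : X → ℝ≥0∞} (hL : Measurable L) {S : Set X}
    (hS : MeasurableSet S) (c : ℝ≥0) :
    4 * c * P S + 2 * ∫⁻ x, L x ∂P
      ≤ 4 * c ^ 2 + ∫⁻ x, L x * L x ∂P + 1 + 4 * c * ∫⁻ x in S, L x ∂P := by
  have hpt : ∀ x, 4 * (c : ℝ≥0∞) * S.indicator 1 x + 2 * L x
      ≤ 4 * c ^ 2 + L x * L x + 1 + 4 * c * S.indicator L x := by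
    intro x
    generalize hl : L x = l
    induction l with
    | top => simp
    | coe l =>
      by_cases hx : x ∈ S
      · rw [Set.indicator_of_mem hx, Set.indicator_of_mem hx, hl, Pi.one_apply]
        norm_cast
        rw [← NNReal.coe_le_coe]
        push_cast
        nlinarith [sq_nonneg (2 * (c : ℝ) + l - 1)]
      · rw [Set.indicator_of_notMem hx, Set.indicator_of_notMem hx]
        norm_cast
        rw [← NNReal.coe_le_coe]
        push_cast
        nlinarith [sq_nonneg ((l : ℝ) - 1), sq_nonneg (c : ℝ)]
  have h := lintegral_mono (μ := P) hpt
  have h1 : Measurable (S.indicator (1 : X → ℝ≥0∞)) := measurable_one.indicator hS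
  rw [lintegral_add_left (h1.const_mul _), lintegral_const_mul _ h1,
    lintegral_const_mul _ hL, lintegral_add_left (by fun_prop), lintegral_add_left (by fun_prop),
    lintegral_add_left (by fun_prop), lintegral_const_mul _ (hL.indicator hS),
    lintegral_indicator_one hS, lintegral_indicator hS] at h
  simpa using h

instance : IsProbabilityMeasure signLaw := by
  constructor
  simp [signLaw, ENNReal.inv_two_add_inv_two]

lemma isProbabilityMeasure_muLaw {ε : ℝ} (h0 : 0 ≤ ε) (h1 : ε ≤ 1) (τ : ℝ) :
    IsProbabilityMeasure (muLaw ε τ) := by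
  constructor
  simp only [muLaw, Measure.add_apply, Measure.smul_apply, measure_univ, smul_eq_mul, mul_one]
  rw [← ENNReal.ofReal_add (by linarith) h0]
  simp

lemma lintegral_signLaw (f : ℝ → ℝ≥0∞) :
    ∫⁻ x, f x ∂signLaw = (f 1 + f (-1)) / 2 := by
  simp only [signLaw, lintegral_add_measure, lintegral_smul_measure, lintegral_dirac, smul_eq_mul]
  rw [ENNReal.div_eq_inv_mul, ENNReal.div_eq_inv_mul, mul_one, mul_add]

lemma lintegral_muLaw (ε τ : ℝ) (f : ℝ → ℝ≥0∞) :
    ∫⁻ x, f x ∂(muLaw ε τ) = ENNReal.ofReal (1 - ε) * f 0 + ENNReal.ofReal ε * f τ := by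
  simp only [muLaw, lintegral_add_measure, lintegral_smul_measure, lintegral_dirac, smul_eq_mul]

lemma lintegral_signLaw_exp (t : ℝ) :
    ∫⁻ x, ∫⁻ y, ENNReal.ofReal (Real.exp (x * y * t)) ∂signLaw ∂signLaw
      = ENNReal.ofReal (Real.cosh t) := by
  simp only [lintegral_signLaw]
  rw [← ENNReal.ofReal_ofNat 2]
  simp only [← ENNReal.ofReal_add (Real.exp_pos _).le (Real.exp_pos _).le]
  rw [← ENNReal.ofReal_div_of_pos two_pos, ← ENNReal.ofReal_div_of_pos two_pos,
    ← ENNReal.ofReal_add (by positivity) (by positivity), ← ENNReal.ofReal_div_of_pos two_pos,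
    Real.cosh_eq]
  congr 1
  simp only [mul_one, one_mul, mul_neg, neg_mul, neg_neg]
  ring

lemma lintegral_pi_signLaw_exp (n : ℕ) (t : ℝ) :
    ∫⁻ x, ∫⁻ y, ENNReal.ofReal (Real.exp ((∑ i, x i * y i) * t))
        ∂(Measure.pi fun _ : Fin n => signLaw) ∂(Measure.pi fun _ : Fin n => signLaw)
      = ENNReal.ofReal (Real.cosh t) ^ n := by
  have h (x y : Fin n → ℝ) : ENNReal.ofReal (Real.exp ((∑ i, x i * y i) * t))
      = ∏ i, ENNReal.ofReal (Real.exp (x i * y i * t)) := by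
    rw [Finset.sum_mul, Real.exp_sum, ENNReal.ofReal_prod_of_nonneg fun i _ => (Real.exp_pos _).le]
  simp_rw [h]
  have h' (x : Fin n → ℝ) := lintegral_pi_prod (fun _ : Fin n => signLaw)
    (f := fun i y => ENNReal.ofReal (Real.exp (x i * y * t))) fun i => by fun_prop
  simp_rw [h']
  rw [lintegral_pi_prod (fun _ : Fin n => signLaw)
    (f := fun _ x => ∫⁻ y, ENNReal.ofReal (Real.exp (x * y * t)) ∂signLaw) fun i => by
      simp only [lintegral_signLaw]; fun_prop]
  simp [lintegral_signLaw_exp]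

lemma lintegral_pi_muLaw_exp (p : ℕ) {ε τ : ℝ} (h0 : 0 ≤ ε) (h1 : ε ≤ 1) (s : ℝ) :
    ∫⁻ x, ∫⁻ y, ENNReal.ofReal (Real.exp (s * ∑ j, x j * y j))
        ∂(Measure.pi fun _ : Fin p => muLaw ε τ) ∂(Measure.pi fun _ : Fin p => muLaw ε τ)
      = ENNReal.ofReal (1 + ε ^ 2 * (Real.exp (s * τ ^ 2) - 1)) ^ p := by
  have := isProbabilityMeasure_muLaw h0 h1 τ
  have h (x y : Fin p → ℝ) : ENNReal.ofReal (Real.exp (s * ∑ i, x i * y i))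
      = ∏ i, ENNReal.ofReal (Real.exp (s * (x i * y i))) := by
    rw [Finset.mul_sum, Real.exp_sum, ENNReal.ofReal_prod_of_nonneg fun i _ => (Real.exp_pos _).le]
  simp_rw [h]
  have h' (x : Fin p → ℝ) := lintegral_pi_prod (fun _ : Fin p => muLaw ε τ)
    (f := fun i y => ENNReal.ofReal (Real.exp (s * (x i * y)))) fun i => by fun_prop
  simp_rw [h']
  rw [lintegral_pi_prod (fun _ : Fin p => muLaw ε τ)
    (f := fun _ x => ∫⁻ y, ENNReal.ofReal (Real.exp (s * (x * y))) ∂(muLaw ε τ)) fun i => by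
      simp only [lintegral_muLaw]; fun_prop]
  simp only [lintegral_muLaw, Finset.prod_const, Finset.card_univ, Fintype.card_fin]
  congr 1
  have h2 : 0 ≤ 1 - ε := by linarith
  have he := fun x : ℝ => (Real.exp_pos x).le
  simp only [← ENNReal.ofReal_mul h0, ← ENNReal.ofReal_mul h2]
  rw [← ENNReal.ofReal_add (mul_nonneg h2 (he _)) (mul_nonneg h0 (he _)),
    ← ENNReal.ofReal_add (mul_nonneg h2 (he _)) (mul_nonneg h0 (he _)),
    ← ENNReal.ofReal_mul h2, ← ENNReal.ofReal_mul h0, ← ENNReal.ofReal_add]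
  · congr 1
    rw [← pow_two τ]
    simp only [mul_zero, zero_mul, Real.exp_zero]
    ring
  · exact mul_nonneg h2 (add_nonneg (mul_nonneg h2 (he _)) (mul_nonneg h0 (he _)))
  · exact mul_nonneg h0 (add_nonneg (mul_nonneg h2 (he _)) (mul_nonneg h0 (he _)))

lemma ae_pi_muLaw (p : ℕ) {ε τ : ℝ} (h0 : 0 ≤ ε) (h1 : ε ≤ 1) :
    ∀ᵐ x ∂(Measure.pi fun _ : Fin p => muLaw ε τ), ∀ j, x j = 0 ∨ x j = τ := by
  have := isProbabilityMeasure_muLaw h0 h1 τ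
  rw [ae_all_iff]
  intro j
  have h : ∀ᵐ y ∂(muLaw ε τ), y = 0 ∨ y = τ := by
    have hm : MeasurableSet {y : ℝ | ¬ (y = 0 ∨ y = τ)} :=
      ((measurableSet_singleton 0).union (measurableSet_singleton τ)).compl
    rw [ae_iff, muLaw, Measure.add_apply, Measure.smul_apply, Measure.smul_apply,
      Measure.dirac_apply' _ hm, Measure.dirac_apply' _ hm]
    simp
  exact (measurePreserving_eval (fun _ : Fin p => muLaw ε τ) j).quasiMeasurePreserving.ae h

lemma pi_muLaw_sum_gt_le (p : ℕ) {ε τ M : ℝ} (h0 : 0 ≤ ε) (h1 : ε ≤ 1) (hτ : 0 < τ)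
    (hM : 0 < M) :
    (Measure.pi fun _ : Fin p => muLaw ε τ) {x | M * τ < ∑ j, x j}
      ≤ ENNReal.ofReal (p * ε / M) := by
  have := isProbabilityMeasure_muLaw h0 h1 τ
  have hMτ : 0 < M * τ := mul_pos hM hτ
  have hmk := meas_ge_le_lintegral_div (μ := Measure.pi fun _ : Fin p => muLaw ε τ)
    (f := fun x => ∑ j, ENNReal.ofReal (x j))
    (Finset.measurable_sum _ fun j _ => by fun_prop).aemeasurable (ε := ENNReal.ofReal (M * τ))
    (by simpa using hMτ) (by simp)
  refine (measure_mono ?_).trans (hmk.trans ?_)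
  · intro x hx
    simp only [Set.mem_ofPred_eq] at hx ⊢
    calc ENNReal.ofReal (M * τ) ≤ ENNReal.ofReal (∑ j, x j) := ENNReal.ofReal_le_ofReal hx.le
      _ ≤ ENNReal.ofReal (∑ j, max (x j) 0) :=
        ENNReal.ofReal_le_ofReal (Finset.sum_le_sum fun j _ => le_max_left _ _)
      _ = ∑ j, ENNReal.ofReal (x j) := by
        rw [ENNReal.ofReal_sum_of_nonneg fun j _ => le_max_right _ _]
        simp
  · rw [lintegral_finsetSum _ fun j _ => by fun_prop]
    have hj (j : Fin p) : ∫⁻ x, ENNReal.ofReal (x j) ∂(Measure.pi fun _ : Fin p => muLaw ε τ)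
        = ENNReal.ofReal (ε * τ) := by
      rw [(measurePreserving_eval (fun _ : Fin p => muLaw ε τ) j).lintegral_comp
        (f := ENNReal.ofReal) (by fun_prop), lintegral_muLaw, ENNReal.ofReal_mul h0]
      simp
    simp only [hj, Finset.sum_const, Finset.card_univ, Fintype.card_fin, nsmul_eq_mul]
    rw [← ENNReal.ofReal_natCast, ← ENNReal.ofReal_mul (by positivity),
      ← ENNReal.ofReal_div_of_pos hMτ]
    refine ENNReal.ofReal_le_ofReal (le_of_eq ?_)
    field_simp

/-- Indicator of `∑ j, x j ≤ B`. -/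
noncomputable def sumInd {p : ℕ} (B : ℝ) : (Fin p → ℝ) → ℝ≥0∞ :=
  {x : Fin p → ℝ | ∑ j, x j ≤ B}.indicator 1

lemma measurableSet_sum_le (p : ℕ) (B : ℝ) : MeasurableSet {x : Fin p → ℝ | ∑ j, x j ≤ B} :=
  measurableSet_le (by fun_prop) measurable_const

@[fun_prop]
lemma measurable_sumInd {p : ℕ} (B : ℝ) : Measurable (sumInd B : (Fin p → ℝ) → ℝ≥0∞) :=
  measurable_one.indicator (measurableSet_sum_le p B)

lemma sumInd_le_one {p : ℕ} (B : ℝ) (x : Fin p → ℝ) : sumInd B x ≤ 1 :=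
  Set.indicator_le' (fun _ _ => le_rfl) (fun _ _ => zero_le) x

/-- Likelihood ratio of `ℓ μ' + Z` against `Z`, set to zero when `∑ j, μ j > B`. -/
noncomputable def truncKer {n p : ℕ} (B : ℝ) (q : (Fin p → ℝ) × (Fin n → ℝ))
    (Z : Fin n → Fin p → ℝ) : ℝ≥0∞ :=
  sumInd B q.1 * matLR (fun i j => q.2 i * q.1 j) Z

lemma measurable_matLR_outer {n p : ℕ} (q : (Fin p → ℝ) × (Fin n → ℝ)) :
    Measurable (matLR fun i j => q.2 i * q.1 j) :=
  measurable_matLR (A := fun _ i j => q.2 i * q.1 j) (fun i j => by fun_prop)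
    fun i j => by fun_prop

lemma measurable_truncKer {n p : ℕ} {Ω : Type*} [MeasurableSpace Ω] (B : ℝ)
    {q : Ω → (Fin p → ℝ) × (Fin n → ℝ)} {Z : Ω → Fin n → Fin p → ℝ}
    (hq : Measurable q) (hZ : Measurable Z) :
    Measurable fun ω => truncKer B (q ω) (Z ω) := by
  unfold truncKer
  refine Measurable.mul (by fun_prop) ?_
  exact measurable_matLR (A := fun ω i j => (q ω).2 i * (q ω).1 j) (fun i j => by fun_prop)
    fun i j => by fun_prop

/-- Law of the parameters `(μ, ℓ)`. -/
noncomputable def priorLaw (n p : ℕ) (ε τ : ℝ) : Measure ((Fin p → ℝ) × (Fin n → ℝ)) :=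
  (Measure.pi fun _ : Fin p => muLaw ε τ).prod (Measure.pi fun _ : Fin n => signLaw)

/-- Mixture likelihood ratio of `ℓ μ' + Z` against `Z`, restricted to `∑ j, μ j ≤ B`. -/
noncomputable def truncLR (n p : ℕ) (ε τ B : ℝ) (Z : Fin n → Fin p → ℝ) : ℝ≥0∞ :=
  ∫⁻ q, truncKer B q Z ∂(priorLaw n p ε τ)

lemma setLIntegral_matLR {n p : ℕ} (A : Fin n → Fin p → ℝ) {S : Set (Fin n → Fin p → ℝ)}
    (hS : MeasurableSet S) :
    ∫⁻ Z in S, matLR A Z ∂(noiseLaw n p)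
      = noiseLaw n p {Z | (fun i j => A i j + Z i j) ∈ S} := by
  rw [← withDensity_apply _ hS, ← noiseLaw_map_add, Measure.map_apply _ hS]
  · rfl
  · exact measurable_pi_lambda _ fun i => measurable_pi_lambda _ fun j => by fun_prop

section

variable {n p : ℕ} {ε τ : ℝ} [IsProbabilityMeasure (muLaw ε τ)]

instance : IsProbabilityMeasure (priorLaw n p ε τ) := by unfold priorLaw; infer_instance

lemma measurable_truncLR (B : ℝ) : Measurable (truncLR n p ε τ B) :=
  Measurable.lintegral_prod_right' (f := fun w : (Fin n → Fin p → ℝ) × _ => truncKer B w.2 w.1)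
    (measurable_truncKer B measurable_snd measurable_fst)

lemma setLIntegral_truncLR (B : ℝ) (S : Set (Fin n → Fin p → ℝ)) :
    ∫⁻ Z in S, truncLR n p ε τ B Z ∂(noiseLaw n p)
      = ∫⁻ q, sumInd B q.1 * ∫⁻ Z in S, matLR (fun i j => q.2 i * q.1 j) Z ∂(noiseLaw n p)
        ∂(priorLaw n p ε τ) := by
  unfold truncLR
  rw [lintegral_lintegral_swap]
  · exact lintegral_congr fun q => lintegral_const_mul _ (measurable_matLR_outer q)
  · exact (measurable_truncKer B measurable_snd measurable_fst).aemeasurable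

lemma jointLaw_dataMap_mem {S : Set (Fin n → Fin p → ℝ)} (hS : MeasurableSet S) :
    jointLaw n p ε τ {ω | dataMap ω ∈ S}
      = ∫⁻ q, noiseLaw n p {Z | (fun i j => q.2 i * q.1 j + Z i j) ∈ S}
        ∂(priorLaw n p ε τ) := by
  have hd : Measurable (dataMap : Omega n p → _) :=
    measurable_pi_lambda _ fun i => measurable_pi_lambda _ fun j => by
      unfold dataMap; fun_prop
  have hm : MeasurableSet {ω : Omega n p | dataMap ω ∈ S} := hd hS
  have hm2 : Measurable fun q : (Fin p → ℝ) × (Fin n → ℝ) =>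
      noiseLaw n p {Z | (fun i j => q.2 i * q.1 j + Z i j) ∈ S} :=
    measurable_measure_prodMk_left (ν := noiseLaw n p)
      (s := {w : ((Fin p → ℝ) × (Fin n → ℝ)) × (Fin n → Fin p → ℝ) |
        (fun i j => w.1.2 i * w.1.1 j + w.2 i j) ∈ S})
      ((measurable_pi_lambda _ fun i => measurable_pi_lambda _ fun j => by fun_prop :
        Measurable fun w : ((Fin p → ℝ) × (Fin n → ℝ)) × (Fin n → Fin p → ℝ) =>
          (fun i j => w.1.2 i * w.1.1 j + w.2 i j)) hS)
  unfold jointLaw priorLaw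
  rw [Measure.prod_apply hm, lintegral_prod_symm _ hm2.aemeasurable]
  refine lintegral_congr fun ℓ => ?_
  rw [Measure.prod_apply (measurable_prodMk_left hm)]
  rfl

lemma setLIntegral_truncLR_le_jointLaw (B : ℝ) {S : Set (Fin n → Fin p → ℝ)}
    (hS : MeasurableSet S) :
    ∫⁻ Z in S, truncLR n p ε τ B Z ∂(noiseLaw n p) ≤ jointLaw n p ε τ {ω | dataMap ω ∈ S} := by
  rw [setLIntegral_truncLR, jointLaw_dataMap_mem hS]
  refine lintegral_mono fun q => ?_
  rw [setLIntegral_matLR _ hS]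
  exact mul_le_of_le_one_left' (sumInd_le_one B _)

lemma lintegral_truncLR (B : ℝ) :
    ∫⁻ Z, truncLR n p ε τ B Z ∂(noiseLaw n p)
      = (Measure.pi fun _ : Fin p => muLaw ε τ) {x | ∑ j, x j ≤ B} := by
  rw [← setLIntegral_univ, setLIntegral_truncLR]
  simp_rw [setLIntegral_matLR _ MeasurableSet.univ]
  unfold priorLaw
  rw [lintegral_prod _ (by simp; fun_prop)]
  simp only [Set.mem_univ, Set.ofPred_true, measure_univ, mul_one, lintegral_const, sumInd]
  rw [lintegral_indicator_one (measurableSet_sum_le p B)]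

lemma lintegral_truncLR_mul_self (B : ℝ) :
    ∫⁻ Z, truncLR n p ε τ B Z * truncLR n p ε τ B Z ∂(noiseLaw n p)
      = ∫⁻ μ, ∫⁻ μ', sumInd B μ * sumInd B μ'
          * ENNReal.ofReal (Real.cosh (∑ j, μ j * μ' j)) ^ n
        ∂(Measure.pi fun _ : Fin p => muLaw ε τ) ∂(Measure.pi fun _ : Fin p => muLaw ε τ) := by
  set Q := priorLaw n p ε τ with hQ
  have hsq (Z : Fin n → Fin p → ℝ) : truncLR n p ε τ B Z * truncLR n p ε τ B Z
      = ∫⁻ w, truncKer B w.1 Z * truncKer B w.2 Z ∂(Q.prod Q) := by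
    have hk : AEMeasurable (fun q => truncKer B q Z) Q :=
      (measurable_truncKer B measurable_id measurable_const).aemeasurable
    rw [lintegral_prod_mul hk hk]
    rfl
  have hexp (w : ((Fin p → ℝ) × (Fin n → ℝ)) × ((Fin p → ℝ) × (Fin n → ℝ))) :
      ∫⁻ Z, truncKer B w.1 Z * truncKer B w.2 Z ∂(noiseLaw n p)
        = sumInd B w.1.1 * sumInd B w.2.1 * ENNReal.ofReal
          (Real.exp ((∑ i, w.1.2 i * w.2.2 i) * ∑ j, w.1.1 j * w.2.1 j)) := by
    have : ∀ Z, truncKer B w.1 Z * truncKer B w.2 Z = sumInd B w.1.1 * sumInd B w.2.1 *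
        (matLR (fun i j => w.1.2 i * w.1.1 j) Z * matLR (fun i j => w.2.2 i * w.2.1 j) Z) :=
      fun Z => by simp only [truncKer]; ring
    simp_rw [this]
    have hm : Measurable fun Z => matLR (fun i j => w.1.2 i * w.1.1 j) Z
        * matLR (fun i j => w.2.2 i * w.2.1 j) Z :=
      (measurable_matLR_outer w.1).mul (measurable_matLR_outer w.2)
    rw [lintegral_const_mul _ hm, lintegral_matLR_mul]
    congr 3
    rw [Finset.sum_mul_sum]
    exact Finset.sum_congr rfl fun i _ => Finset.sum_congr rfl fun j _ => by ring
  simp_rw [hsq]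
  rw [lintegral_lintegral_swap ((measurable_truncKer B (by fun_prop) (by fun_prop)).mul
    (measurable_truncKer B (by fun_prop) (by fun_prop))).aemeasurable]
  simp_rw [hexp]
  have hG : Measurable fun w : ((Fin p → ℝ) × (Fin n → ℝ)) × ((Fin p → ℝ) × (Fin n → ℝ)) =>
      sumInd B w.1.1 * sumInd B w.2.1 * ENNReal.ofReal
          (Real.exp ((∑ i, w.1.2 i * w.2.2 i) * ∑ j, w.1.1 j * w.2.1 j)) := by
    fun_prop
  rw [lintegral_prod _ hG.aemeasurable, hQ, priorLaw,
    lintegral_prod _ hG.lintegral_prod_right'.aemeasurable]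
  refine lintegral_congr fun μ => ?_
  have hin (ℓ : Fin n → ℝ) := lintegral_prod (μ := Measure.pi fun _ : Fin p => muLaw ε τ)
    (ν := Measure.pi fun _ : Fin n => signLaw)
    (fun q : (Fin p → ℝ) × (Fin n → ℝ) => sumInd B μ * sumInd B q.1 * ENNReal.ofReal
        (Real.exp ((∑ i, ℓ i * q.2 i) * ∑ j, μ j * q.1 j))) (by fun_prop)
  simp_rw [hin]
  have hm4 : Measurable fun w : ((Fin n → ℝ) × (Fin p → ℝ)) × (Fin n → ℝ) =>
      sumInd B μ * sumInd B w.1.2 * ENNReal.ofReal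
        (Real.exp ((∑ i, w.1.1 i * w.2 i) * ∑ j, μ j * w.1.2 j)) := by fun_prop
  rw [lintegral_lintegral_swap (hm4.lintegral_prod_right').aemeasurable]
  refine lintegral_congr fun μ' => ?_
  have hm5 : Measurable fun w : (Fin n → ℝ) × (Fin n → ℝ) => ENNReal.ofReal
      (Real.exp ((∑ i, w.1 i * w.2 i) * ∑ j, μ j * μ' j)) := by fun_prop
  have hc (ℓ : Fin n → ℝ) := lintegral_const_mul (μ := Measure.pi fun _ : Fin n => signLaw)
    (sumInd B μ * sumInd B μ') (f := fun ℓ' => ENNReal.ofReal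
      (Real.exp ((∑ i, ℓ i * ℓ' i) * ∑ j, μ j * μ' j))) (by fun_prop)
  simp_rw [hc]
  rw [lintegral_const_mul _ hm5.lintegral_prod_right', lintegral_pi_signLaw_exp]

end

lemma cosh_pow_le (n : ℕ) {p : ℕ} {τ M K : ℝ} (hτ : 0 < τ)
    (hb : n * τ ^ 2 ≤ 1 ∨ n * τ ^ 4 * M / 2 ≤ 1) {x y : Fin p → ℝ}
    (hx : ∀ j, x j = 0 ∨ x j = τ) (hy : ∀ j, y j = 0 ∨ y j = τ) (hM : ∑ j, x j ≤ M * τ) :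
    Real.cosh (∑ j, x j * y j) ^ n
      ≤ Real.exp (n * τ ^ 4 * K ^ 2 / 2) + Real.exp (-K) * Real.exp (2 / τ ^ 2 * ∑ j, x j * y j) := by
  have hx0 (j) : 0 ≤ x j := by rcases hx j with h | h <;> rw [h]; exact hτ.le
  have hy0 (j) : 0 ≤ y j := by rcases hy j with h | h <;> rw [h]; exact hτ.le
  have hyτ (j) : y j ≤ τ := by rcases hy j with h | h <;> rw [h]; exact hτ.le
  have ht0 : 0 ≤ ∑ j, x j * y j := Finset.sum_nonneg fun j _ => mul_nonneg (hx0 j) (hy0 j)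
  have htM : ∑ j, x j * y j ≤ M * τ ^ 2 := by
    calc ∑ j, x j * y j ≤ ∑ j, x j * τ :=
          Finset.sum_le_sum fun j _ => mul_le_mul_of_nonneg_left (hyτ j) (hx0 j)
      _ = (∑ j, x j) * τ := by rw [Finset.sum_mul]
      _ ≤ M * τ * τ := mul_le_mul_of_nonneg_right hM hτ.le
      _ = M * τ ^ 2 := by ring
  generalize ∑ j, x j * y j = t at ht0 htM
  have hn : (0 : ℝ) ≤ n := n.cast_nonneg
  have hτ2 : 0 < τ ^ 2 := by positivity
  have hsq : Real.cosh t ^ n ≤ Real.exp (n * (t ^ 2 / 2)) := by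
    rw [Real.exp_nat_mul]
    exact pow_le_pow_left₀ (Real.cosh_pos t).le (Real.cosh_le_exp_half_sq t) n
  obtain ⟨r, rfl⟩ : ∃ r, t = r * τ ^ 2 := ⟨t / τ ^ 2, by field_simp⟩
  have hr0 : 0 ≤ r := nonneg_of_mul_nonneg_left ht0 hτ2
  have hrM : r ≤ M := le_of_mul_le_mul_right htM hτ2
  have hdiv : 2 / τ ^ 2 * (r * τ ^ 2) = 2 * r := by field_simp
  rw [hdiv, ← Real.exp_add]
  rcases le_or_gt r K with hrK | hrK
  · refine (hsq.trans (Real.exp_le_exp.2 ?_)).trans (le_add_of_nonneg_right (Real.exp_pos _).le)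
    have : r ^ 2 ≤ K ^ 2 := pow_le_pow_left₀ hr0 hrK 2
    have h4 : 0 ≤ n * τ ^ 4 := by positivity
    nlinarith [mul_le_mul_of_nonneg_left this h4]
  · have key : Real.cosh (r * τ ^ 2) ^ n ≤ Real.exp r := by
      rcases hb with hb | hb
      · have hc : Real.cosh (r * τ ^ 2) ≤ Real.exp (r * τ ^ 2) := by
          rw [Real.cosh_eq]
          have : Real.exp (-(r * τ ^ 2)) ≤ Real.exp (r * τ ^ 2) :=
            Real.exp_le_exp.2 (by linarith)
          linarith
        refine (pow_le_pow_left₀ (Real.cosh_pos _).le hc n).trans ?_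
        rw [← Real.exp_nat_mul]
        refine Real.exp_le_exp.2 ?_
        nlinarith [mul_le_mul_of_nonneg_left hb hr0]
      · refine hsq.trans (Real.exp_le_exp.2 ?_)
        have h4 : 0 ≤ n * τ ^ 4 * r := by positivity
        nlinarith [mul_le_mul_of_nonneg_left hb hr0, mul_le_mul_of_nonneg_left hrM h4]
    refine (key.trans (Real.exp_le_exp.2 ?_)).trans (le_add_of_nonneg_left (Real.exp_pos _).le)
    linarith

lemma lintegral_truncLR_mul_self_le {n p : ℕ} {ε τ M K : ℝ} (h0 : 0 ≤ ε) (h1 : ε ≤ 1)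
    (hτ : 0 < τ) (hb : n * τ ^ 2 ≤ 1 ∨ n * τ ^ 4 * M / 2 ≤ 1) :
    ∫⁻ Z, truncLR n p ε τ (M * τ) Z * truncLR n p ε τ (M * τ) Z ∂(noiseLaw n p)
      ≤ ENNReal.ofReal
        (Real.exp (n * τ ^ 4 * K ^ 2 / 2) + Real.exp (7 * (p * ε ^ 2) - K)) := by
  have := isProbabilityMeasure_muLaw h0 h1 τ
  rw [lintegral_truncLR_mul_self]
  calc _ ≤ ∫⁻ x, ∫⁻ y, (ENNReal.ofReal (Real.exp (n * τ ^ 4 * K ^ 2 / 2)) +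
          ENNReal.ofReal (Real.exp (-K)) *
            ENNReal.ofReal (Real.exp (2 / τ ^ 2 * ∑ j, x j * y j)))
        ∂(Measure.pi fun _ : Fin p => muLaw ε τ) ∂(Measure.pi fun _ : Fin p => muLaw ε τ) := by
        refine lintegral_mono_ae ?_
        filter_upwards [ae_pi_muLaw p h0 h1 (τ := τ)] with x hx
        refine lintegral_mono_ae ?_
        filter_upwards [ae_pi_muLaw p h0 h1 (τ := τ)] with y hy
        by_cases hxB : ∑ j, x j ≤ M * τ
        · refine (mul_le_of_le_one_left' (mul_le_one' (sumInd_le_one _ _)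
            (sumInd_le_one _ _))).trans ?_
          rw [← ENNReal.ofReal_mul (Real.exp_pos _).le,
            ← ENNReal.ofReal_add (Real.exp_pos _).le (by positivity),
            ← ENNReal.ofReal_pow (Real.cosh_pos _).le]
          exact ENNReal.ofReal_le_ofReal (cosh_pow_le n hτ hb hx hy hxB)
        · have : sumInd (M * τ) x = 0 :=
            Set.indicator_of_notMem (s := {x : Fin p → ℝ | ∑ j, x j ≤ M * τ}) hxB _
          simp [this]
    _ = ENNReal.ofReal (Real.exp (n * τ ^ 4 * K ^ 2 / 2)) + ENNReal.ofReal (Real.exp (-K)) *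
          ENNReal.ofReal (1 + ε ^ 2 * (Real.exp 2 - 1)) ^ p := by
        have hm : Measurable fun w : (Fin p → ℝ) × (Fin p → ℝ) =>
            ENNReal.ofReal (Real.exp (2 / τ ^ 2 * ∑ j, w.1 j * w.2 j)) := by fun_prop
        have hs (x : Fin p → ℝ) : Measurable fun y : Fin p → ℝ =>
            ENNReal.ofReal (Real.exp (2 / τ ^ 2 * ∑ j, x j * y j)) := by fun_prop
        simp_rw [lintegral_add_left measurable_const, lintegral_const_mul _ (hs _)]
        rw [lintegral_const_mul _ hm.lintegral_prod_right', lintegral_pi_muLaw_exp p h0 h1]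
        simp only [lintegral_const, measure_univ, mul_one]
        rw [div_mul_cancel₀ _ (by positivity)]
    _ ≤ _ := by
        have he : Real.exp 2 - 1 ≤ 7 := by
          have h := Real.exp_one_lt_d9
          have : Real.exp 2 = Real.exp 1 * Real.exp 1 := by rw [← Real.exp_add]; norm_num
          nlinarith [Real.exp_pos 1]
        have h2 : 0 ≤ Real.exp 2 - 1 := by linarith [Real.add_one_le_exp (2 : ℝ)]
        rw [← ENNReal.ofReal_pow (by positivity), ← ENNReal.ofReal_mul (Real.exp_pos _).le,
          ← ENNReal.ofReal_add (Real.exp_pos _).le (by positivity)]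
        refine ENNReal.ofReal_le_ofReal (add_le_add le_rfl ?_)
        have hone : 1 + ε ^ 2 * (Real.exp 2 - 1) ≤ Real.exp (7 * ε ^ 2) := by
          nlinarith [Real.add_one_le_exp (7 * ε ^ 2), mul_le_mul_of_nonneg_left he (sq_nonneg ε)]
        calc _ ≤ Real.exp (-K) * Real.exp (7 * ε ^ 2) ^ p :=
              mul_le_mul_of_nonneg_left (pow_le_pow_left₀ (by positivity) hone p)
                (Real.exp_pos _).le
          _ = _ := by
            rw [← Real.exp_nat_mul, ← Real.exp_add]
            congr 1
            ring

lemma testErr_ge {n p : ℕ} {ε τ M K c : ℝ} (h0 : 0 ≤ ε) (h1 : ε ≤ 1) (hτ : 0 < τ) (hM : 0 < M)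
    (hc : 0 < c) (hb : n * τ ^ 2 ≤ 1 ∨ n * τ ^ 4 * M / 2 ≤ 1)
    {R : Set (Fin n → Fin p → ℝ)} (hR : MeasurableSet R) :
    1 - c - (Real.exp (n * τ ^ 4 * K ^ 2 / 2) + Real.exp (7 * (p * ε ^ 2) - K) - 1
      + 2 * (p * ε / M)) / (4 * c) ≤ testErr n p ε τ R := by
  have := isProbabilityMeasure_muLaw h0 h1 τ
  have : IsProbabilityMeasure (jointLaw n p ε τ) := by unfold jointLaw; infer_instance
  have hmain := truncated_chiSquare_bound (noiseLaw n p)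
    (measurable_truncLR (ε := ε) (τ := τ) (M * τ)) hR.compl c.toNNReal
  have hjoint := setLIntegral_truncLR_le_jointLaw (ε := ε) (τ := τ) (M * τ) hR.compl
  have hsec := lintegral_truncLR_mul_self_le (n := n) (p := p) (K := K) h0 h1 hτ hb
  rw [lintegral_truncLR] at hmain
  have hG : 1 - p * ε / M ≤
      ((Measure.pi fun _ : Fin p => muLaw ε τ) {x | ∑ j, x j ≤ M * τ}).toReal := by
    have h := pi_muLaw_sum_gt_le p h0 h1 hτ hM
    have hcomp : {x : Fin p → ℝ | M * τ < ∑ j, x j} = {x | ∑ j, x j ≤ M * τ}ᶜ := by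
      ext x; simp
    have hr := ENNReal.toReal_mono ENNReal.ofReal_ne_top h
    rw [ENNReal.toReal_ofReal (by positivity), hcomp, ← measureReal_def,
      probReal_compl_eq_one_sub (measurableSet_sum_le p _)] at hr
    rw [← measureReal_def]
    linarith
  have hle := hmain.trans (add_le_add (add_le_add (add_le_add le_rfl hsec) le_rfl)
    (mul_le_mul_right hjoint _))
  have hreal := ENNReal.toReal_mono (by finiteness) hle
  have hP0 : (noiseLaw n p Rᶜ).toReal = 1 - (noiseLaw n p R).toReal :=
    probReal_compl_eq_one_sub hR
  rw [ENNReal.toReal_add (by finiteness) (by finiteness),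
    ENNReal.toReal_add (by finiteness) (by finiteness),
    ENNReal.toReal_add (by finiteness) (by finiteness),
    ENNReal.toReal_add (by finiteness) (by finiteness)] at hreal
  simp only [ENNReal.toReal_mul, ENNReal.toReal_pow, ENNReal.toReal_ofNat, ENNReal.coe_toReal,
    Real.coe_toNNReal c hc.le, ENNReal.toReal_one, hP0] at hreal
  rw [ENNReal.toReal_ofReal (by positivity)] at hreal
  unfold testErr
  change _ ≤ _ + (jointLaw n p ε τ {ω | dataMap ω ∈ Rᶜ}).toReal
  set T₁ := (noiseLaw n p R).toReal
  set T₂ := (jointLaw n p ε τ {ω | dataMap ω ∈ Rᶜ}).toReal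
  rw [sub_le_iff_le_add, ← sub_le_iff_le_add', le_div_iff₀ (by positivity)]
  nlinarith

lemma testErr_le_two {n p : ℕ} {ε : ℝ} (h0 : 0 ≤ ε) (h1 : ε ≤ 1) (τ : ℝ)
    (R : Set (Fin n → Fin p → ℝ)) : testErr n p ε τ R ≤ 2 := by
  have := isProbabilityMeasure_muLaw h0 h1 τ
  have : IsProbabilityMeasure (jointLaw n p ε τ) := by unfold jointLaw; infer_instance
  have h2 : (noiseLaw n p).real R ≤ 1 := measureReal_le_one
  have h3 : (jointLaw n p ε τ).real {ω | dataMap ω ∉ R} ≤ 1 := measureReal_le_one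
  unfold testErr
  simp only [measureReal_def] at h2 h3
  linarith


lemma tendsto_natCast_rpow_of_neg {e : ℝ} (he : e < 0) :
    Filter.Tendsto (fun p : ℕ => (p : ℝ) ^ e) Filter.atTop (nhds 0) := by
  have h := (tendsto_rpow_neg_atTop (neg_pos.2 he)).comp tendsto_natCast_atTop_atTop
  simpa [Function.comp_def] using h

lemma nDim_le {p : ℕ} (hp : 1 ≤ p) {θ : ℝ} (hθ : 0 < θ) :
    (nDim p θ : ℝ) ≤ 2 * (p : ℝ) ^ θ := by
  have h1 : (1 : ℝ) ≤ (p : ℝ) ^ θ := Real.one_le_rpow (by exact_mod_cast hp) hθ.le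
  have h2 := (Nat.ceil_lt_add_one (zero_le_one.trans h1)).le
  unfold nDim
  linarith

lemma tendsto_nDim_mul_sq {α β θ : ℝ} (hθ : 0 < θ) (h1 : (2 + θ - 4 * β) / 4 < α)
    (h2 : θ / 4 < α) :
    Filter.Tendsto (fun p : ℕ => (nDim p θ : ℝ) * ((p : ℝ) ^ (-α)) ^ 4 *
      (8 * (p : ℝ) ^ (1 - 2 * β) + (p : ℝ) ^ ((4 * α - θ) / 4)) ^ 2 / 2)
      Filter.atTop (nhds 0) := by
  have ha := (tendsto_natCast_rpow_of_neg (e := θ - 4 * α + 2 - 4 * β) (by linarith)).const_mul 128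
  have hb := (tendsto_natCast_rpow_of_neg (e := -((4 * α - θ) / 2)) (by linarith)).const_mul 2
  have hab := ha.add hb
  simp only [mul_zero, add_zero] at hab
  refine squeeze_zero' (Filter.Eventually.of_forall fun p => by positivity) ?_ hab
  filter_upwards [Filter.eventually_ge_atTop 1] with p hp
  have hp0 : (0 : ℝ) < p := by exact_mod_cast hp
  have e1 : (p : ℝ) ^ (θ - 4 * α + 2 - 4 * β)
      = (p : ℝ) ^ θ * ((p : ℝ) ^ (-α)) ^ 4 * ((p : ℝ) ^ (1 - 2 * β)) ^ 2 := by
    simp only [← Real.rpow_mul_natCast hp0.le, ← Real.rpow_add hp0]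
    congr 1; push_cast; ring
  have e2 : (p : ℝ) ^ (-((4 * α - θ) / 2))
      = (p : ℝ) ^ θ * ((p : ℝ) ^ (-α)) ^ 4 * ((p : ℝ) ^ ((4 * α - θ) / 4)) ^ 2 := by
    simp only [← Real.rpow_mul_natCast hp0.le, ← Real.rpow_add hp0]
    congr 1; push_cast; ring
  rw [e1, e2]
  have hn := nDim_le hp hθ
  set x := (p : ℝ) ^ (1 - 2 * β)
  set y := (p : ℝ) ^ ((4 * α - θ) / 4)
  have hxy : (8 * x + y) ^ 2 ≤ 2 * (64 * x ^ 2 + y ^ 2) := by nlinarith [sq_nonneg (8 * x - y)]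
  calc _ ≤ 2 * (p : ℝ) ^ θ * ((p : ℝ) ^ (-α)) ^ 4 * (2 * (64 * x ^ 2 + y ^ 2)) / 2 := by gcongr
    _ = _ := by ring

lemma tendsto_exp_sub {β s : ℝ} (hs : 0 < s) :
    Filter.Tendsto (fun p : ℕ => Real.exp (7 * ((p : ℝ) * ((p : ℝ) ^ (-β)) ^ 2) -
      (8 * (p : ℝ) ^ (1 - 2 * β) + (p : ℝ) ^ s))) Filter.atTop (nhds 0) := by
  have h : Filter.Tendsto (fun p : ℕ => Real.exp (-(p : ℝ) ^ s)) Filter.atTop (nhds 0) :=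
    Real.tendsto_exp_neg_atTop_nhds_zero.comp
      ((tendsto_rpow_atTop hs).comp tendsto_natCast_atTop_atTop)
  refine squeeze_zero' (Filter.Eventually.of_forall fun p => (Real.exp_pos _).le) ?_ h
  filter_upwards [Filter.eventually_ge_atTop 1] with p hp
  have hp0 : (0 : ℝ) < p := by exact_mod_cast hp
  have e : (p : ℝ) * ((p : ℝ) ^ (-β)) ^ 2 = (p : ℝ) ^ (1 - 2 * β) := by
    nth_rw 1 [← Real.rpow_one (p : ℝ)]
    rw [← Real.rpow_mul_natCast hp0.le, ← Real.rpow_add hp0]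
    congr 1; push_cast; ring
  rw [e]
  have : 0 < (p : ℝ) ^ (1 - 2 * β) := Real.rpow_pos_of_pos hp0 _
  exact Real.exp_le_exp.2 (by linarith)

lemma exists_slack {α β θ : ℝ} (hθ : 0 < θ) (h : min (θ / 2) ((1 + θ - β) / 4) < α) :
    ∃ s : ℝ, 0 < s ∧ ∀ᶠ p : ℕ in Filter.atTop,
      (nDim p θ : ℝ) * ((p : ℝ) ^ (-α)) ^ 2 ≤ 1 ∨
        (nDim p θ : ℝ) * ((p : ℝ) ^ (-α)) ^ 4 * (p : ℝ) ^ (1 - β + s) / 2 ≤ 1 := by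
  rcases min_lt_iff.1 h with h | h
  · refine ⟨1, one_pos, ?_⟩
    have ht := (tendsto_natCast_rpow_of_neg (e := θ - 2 * α) (by linarith)).eventually_le_const
      (show (0 : ℝ) < 1 / 2 by norm_num)
    filter_upwards [ht, Filter.eventually_ge_atTop 1] with p hp1 hp
    have hp0 : (0 : ℝ) < p := by exact_mod_cast hp
    have e : (p : ℝ) ^ (θ - 2 * α) = (p : ℝ) ^ θ * ((p : ℝ) ^ (-α)) ^ 2 := by
      simp only [← Real.rpow_mul_natCast hp0.le, ← Real.rpow_add hp0]
      congr 1; push_cast; ring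
    rw [e] at hp1
    left
    nlinarith [mul_le_mul_of_nonneg_right (nDim_le hp hθ) (sq_nonneg ((p : ℝ) ^ (-α)))]
  · refine ⟨(4 * α - (1 + θ - β)) / 2, by linarith, ?_⟩
    set s := (4 * α - (1 + θ - β)) / 2 with hs
    have ht := (tendsto_natCast_rpow_of_neg (e := -s) (by linarith)).eventually_le_const
      (show (0 : ℝ) < 1 by norm_num)
    filter_upwards [ht, Filter.eventually_ge_atTop 1] with p hp1 hp
    have hp0 : (0 : ℝ) < p := by exact_mod_cast hp
    have e : (p : ℝ) ^ (-s) = (p : ℝ) ^ θ * ((p : ℝ) ^ (-α)) ^ 4 * (p : ℝ) ^ (1 - β + s) := by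
      simp only [← Real.rpow_mul_natCast hp0.le, ← Real.rpow_add hp0]
      congr 1; push_cast; rw [hs]; ring
    rw [e] at hp1
    right
    calc _ ≤ 2 * (p : ℝ) ^ θ * ((p : ℝ) ^ (-α)) ^ 4 * (p : ℝ) ^ (1 - β + s) / 2 := by
          gcongr; exact nDim_le hp hθ
      _ ≤ 1 := by linarith

lemma eventually_testErr_ge {α β θ : ℝ} (hβ0 : 0 < β) (hθ0 : 0 < θ) (hβ1 : β < 1)
    (hmain : etaHyp θ β < α) (R : (p : ℕ) → Set (Fin (nDim p θ) → Fin p → ℝ))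
    (hmeas : ∀ p, MeasurableSet (R p)) {c : ℝ} (hc : 0 < c) :
    ∀ᶠ p : ℕ in Filter.atTop, 1 - 2 * c ≤
      testErr (nDim p θ) p ((p : ℝ) ^ (-β)) ((p : ℝ) ^ (-α)) (R p) := by
  obtain ⟨hm1, hm2⟩ := max_lt_iff.1 hmain
  have hα : θ / 4 < α := by
    rcases min_lt_iff.1 hm2 with h | h <;> linarith
  obtain ⟨s, hs, hev⟩ := exists_slack hθ0 hm2
  have l1 := (Real.continuous_exp.tendsto 0).comp (tendsto_nDim_mul_sq hθ0 hm1 hα)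
  have l2 := tendsto_exp_sub (β := β) (s := (4 * α - θ) / 4) (by linarith)
  have l3 : Filter.Tendsto (fun p : ℕ => (p : ℝ) * (p : ℝ) ^ (-β) / (p : ℝ) ^ (1 - β + s))
      Filter.atTop (nhds 0) := by
    refine (tendsto_natCast_rpow_of_neg (neg_lt_zero.2 hs)).congr' ?_
    filter_upwards [Filter.eventually_ge_atTop 1] with p hp
    have hp0 : (0 : ℝ) < p := by exact_mod_cast hp
    rw [← Real.rpow_one_add' hp0.le (by linarith), ← Real.rpow_sub hp0]
    congr 1; ring
  have l := ((((l1.add l2).sub_const 1).add (l3.const_mul 2)).div_const (4 * c))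
  simp only [Real.exp_zero, add_zero, sub_self, mul_zero, zero_div] at l
  filter_upwards [l.eventually_le_const hc, hev, Filter.eventually_ge_atTop 1] with p hp1 hb hp
  have hp0 : (0 : ℝ) < p := by exact_mod_cast hp
  refine le_trans ?_ (testErr_ge (M := (p : ℝ) ^ (1 - β + s))
    (K := 8 * (p : ℝ) ^ (1 - 2 * β) + (p : ℝ) ^ ((4 * α - θ) / 4)) (by positivity)
    (Real.rpow_le_one_of_one_le_of_nonpos (by exact_mod_cast hp) (by linarith))
    (by positivity) (by positivity) hc hb (hmeas p))
  simp only [Function.comp_apply] at hp1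
  linarith
end ARWPaper

open ARWPaper Filter in
/-- statistical lower bound for global hypothesis testing. If
`α > η^hyp_θ(β)`, then for every sequence of measurable tests (rejection regions),
the sum of type I and type II errors satisfies `liminf_p Err ≥ 1`. -/
theorem hypothesis_testing_lower_bound
    (α β θ : ℝ) (hα0 : 0 < α) (hα1 : α < 1) (hβ0 : 0 < β) (hβ1 : β < 1)
    (hθ0 : 0 < θ) (hθ1 : θ < 1) (hmain : etaHyp θ β < α)
    (R : (p : ℕ) → Set (Fin (nDim p θ) → Fin p → ℝ))
    (hmeas : ∀ p, MeasurableSet (R p)) :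
    (1 : ℝ) ≤ Filter.liminf
      (fun p : ℕ => testErr (nDim p θ) p ((p : ℝ) ^ (-β)) ((p : ℝ) ^ (-α)) (R p))
      Filter.atTop := by
  have hbdd : IsCoboundedUnder (· ≥ ·) atTop (fun p : ℕ =>
      testErr (nDim p θ) p ((p : ℝ) ^ (-β)) ((p : ℝ) ^ (-α)) (R p)) := by
    refine IsBoundedUnder.isCoboundedUnder_ge ⟨2, ?_⟩
    rw [eventually_map]
    filter_upwards [eventually_ge_atTop 1] with p hp
    exact testErr_le_two (by positivity)
      (Real.rpow_le_one_of_one_le_of_nonpos (by exact_mod_cast hp) (by linarith)) _ _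
  refine le_of_forall_pos_le_add fun c hc => ?_
  have h := le_liminf_of_le hbdd
    (eventually_testErr_ge hβ0 hθ0 hβ1 hmain R hmeas (half_pos hc))
  linarith
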